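/- For every ν ∈ ℝ with ν ≠ 0 and every r ∈ ℤ there exists M > 0 such that: for all a, s ∈ ℝ with |s| > M, if every solution x of the class-D equation with parameters (ν, a, s) satisfies x(2π) = x(0) + 2πr (i.e., (a,s) is a constriction with rotation number r), then a = r. -/

import Mathlib

open Real

/-- A solution of the class-D equation `ẋ = ν sin x + a + s sin t`. -/
def IsClassDSolution (ν a s : ℝ) (x : ℝ → ℝ) : Prop :=
  ∀ t : ℝ, HasDerivAt x (ν * Real.sin (x t) + a + s * Real.sin t) t

/-- A sequence whose `n + 1`-st term is at most `L / (n + 1)` times any bound on the earlier terms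
is bounded. -/
lemma exists_forall_le_of_succ_le_div {m : ℕ → ℝ} {L : ℝ}
    (h : ∀ n C, (∀ k ≤ n, m k ≤ C) → m (n + 1) ≤ L / (n + 1) * C) : ∃ C, ∀ n, m n ≤ C := by
  obtain ⟨N, hN⟩ := exists_nat_ge L
  refine ⟨∑ k ∈ Finset.range (N + 1), |m k|, fun n => ?_⟩
  have hC : 0 ≤ ∑ k ∈ Finset.range (N + 1), |m k| := Finset.sum_nonneg fun _ _ => abs_nonneg _
  induction n using Nat.strong_induction_on with
  | _ n ih =>
    by_cases hn : n ≤ N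
    · exact (le_abs_self _).trans (Finset.single_le_sum (f := fun k => |m k|)
        (fun _ _ => abs_nonneg _) (Finset.mem_range.2 (Nat.lt_succ_of_le hn)))
    · obtain ⟨j, rfl⟩ : ∃ j, n = j + 1 := ⟨n - 1, by omega⟩
      refine (h j _ fun k hk => ih k (by omega)).trans ?_
      have hj : L / (j + 1 : ℝ) ≤ 1 := by
        rw [div_le_one (by positivity)]
        have : (N : ℝ) ≤ j := by exact_mod_cast (by omega : N ≤ j)
        linarith
      nlinarith

/-- Termwise differentiation of an everywhere convergent power series. -/
lemma hasDerivAt_tsum_mul_pow {c : ℕ → ℂ} (hc : ∀ R : ℝ, Summable fun n => ‖c n‖ * R ^ n) (t : ℂ) :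
    HasDerivAt (fun t => ∑' n, c n * t ^ n) (∑' n, (n + 1) * c (n + 1) * t ^ n) t := by
  set R : ℝ := ‖t‖ + 1 with hR
  have hR1 : 1 ≤ R := by simp [hR]
  have hu : Summable fun n => ‖c n‖ * (2 * R) ^ n := hc (2 * R)
  have hbd : ∀ (n : ℕ) (y : ℂ), y ∈ Metric.ball (0 : ℂ) R →
      ‖c n * (n * y ^ (n - 1))‖ ≤ ‖c n‖ * (2 * R) ^ n := by
    intro n y hy
    have hy' : ‖y‖ ≤ R := by simpa using (Metric.mem_ball.1 hy).le
    rw [norm_mul, norm_mul, norm_pow, Complex.norm_natCast, mul_pow]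
    have h2 : (n : ℝ) ≤ 2 ^ n := by exact_mod_cast Nat.lt_two_pow_self.le
    have h3 : ‖y‖ ^ (n - 1) ≤ R ^ n :=
      (pow_le_pow_left₀ (norm_nonneg _) hy' _).trans (pow_le_pow_right₀ hR1 (Nat.sub_le _ _))
    gcongr
  have ht : t ∈ Metric.ball (0 : ℂ) R := by simp [hR]
  have key := hasDerivAt_tsum_of_isPreconnected (g := fun n t => c n * t ^ n)
    (g' := fun n y => c n * (n * y ^ (n - 1))) hu Metric.isOpen_ball
    (convex_ball (0 : ℂ) R).isPreconnected
    (fun n y _ => (hasDerivAt_pow n y).const_mul (c n)) hbd (y₀ := 0)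
    (Metric.mem_ball_self (by positivity)) ?_ ht
  · have hs : Summable fun n => c n * (n * t ^ (n - 1)) :=
      Summable.of_norm_bounded hu fun n => hbd n t ht
    rw [hs.tsum_eq_zero_add] at key
    simpa [mul_comm, mul_left_comm, mul_assoc] using key
  · refine Summable.of_norm_bounded (hc 0) fun n => ?_
    simp

/-- Taylor coefficients at the origin of the solution `(u, v)` of `u' = g u + b v`, `v' = b u` with
initial value `(p, q)`, where `c` is the sequence of Taylor coefficients of `g`. -/
noncomputable def systemCoeff (c : ℕ → ℂ) (b p q : ℂ) : ℕ → ℂ × ℂ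
  | 0 => (p, q)
  | n + 1 =>
    ((∑ k : Fin (n + 1), (systemCoeff c b p q k).1 * c (n - k) + b * (systemCoeff c b p q n).2) /
        (n + 1),
      b * (systemCoeff c b p q n).1 / (n + 1))

lemma summable_norm_systemCoeff_mul_pow {c : ℕ → ℂ} (b p q : ℂ)
    (hc : ∀ R : ℝ, Summable fun n => ‖c n‖ * R ^ n) (R : ℝ) :
    Summable fun n => ‖systemCoeff c b p q n‖ * R ^ n := by
  have bound : ∀ R : ℝ, 0 < R → ∃ C, ∀ n, ‖systemCoeff c b p q n‖ * R ^ n ≤ C := by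
    intro R hR
    set S : ℝ := ∑' n, ‖c n‖ * R ^ n with hS
    apply exists_forall_le_of_succ_le_div (L := (S + ‖b‖) * R)
    intro n C hC
    have hS0 : 0 ≤ S := tsum_nonneg fun n => by positivity
    have hC0 : 0 ≤ C :=
      (by positivity : (0 : ℝ) ≤ ‖systemCoeff c b p q 0‖ * R ^ 0).trans (hC 0 n.zero_le)
    have hn : (0 : ℝ) < n + 1 := by positivity
    have hfst : ∀ k ≤ n, ‖(systemCoeff c b p q k).1‖ * R ^ k ≤ C := fun k hk =>
      (mul_le_mul_of_nonneg_right (norm_fst_le _) (by positivity)).trans (hC k hk)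
    have hsnd : ∀ k ≤ n, ‖(systemCoeff c b p q k).2‖ * R ^ k ≤ C := fun k hk =>
      (mul_le_mul_of_nonneg_right (norm_snd_le _) (by positivity)).trans (hC k hk)
    have hsum : ‖∑ k : Fin (n + 1), (systemCoeff c b p q k).1 * c (n - k)‖ * R ^ n ≤ S * C := by
      rw [Fin.sum_univ_eq_sum_range (fun k => (systemCoeff c b p q k).1 * c (n - k)) (n + 1)]
      calc _ ≤ (∑ k ∈ Finset.range (n + 1), ‖(systemCoeff c b p q k).1 * c (n - k)‖) * R ^ n := by
            gcongr; exact norm_sum_le _ _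
        _ ≤ ∑ k ∈ Finset.range (n + 1), C * (‖c (n - k)‖ * R ^ (n - k)) := by
            rw [Finset.sum_mul]
            refine Finset.sum_le_sum fun k hk => ?_
            have hk' : k ≤ n := Nat.lt_succ_iff.1 (Finset.mem_range.1 hk)
            calc _ = (‖(systemCoeff c b p q k).1‖ * R ^ k) * (‖c (n - k)‖ * R ^ (n - k)) := by
                  rw [norm_mul, ← pow_mul_pow_sub R hk']; ring
              _ ≤ _ := mul_le_mul_of_nonneg_right (hfst k hk') (by positivity)
        _ = C * ∑ k ∈ Finset.range (n + 1), ‖c k‖ * R ^ k := by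
            rw [← Finset.mul_sum]
            congr 1
            exact Finset.sum_range_reflect (fun k => ‖c k‖ * R ^ k) (n + 1)
        _ ≤ C * S := by
            gcongr
            exact (hc R).sum_le_tsum _ fun _ _ => by positivity
        _ = S * C := mul_comm _ _
    have hR' : (S + ‖b‖) * R / (n + 1) * C = (S * C + ‖b‖ * C) * R / (n + 1) := by ring
    rw [hR', le_div_iff₀ hn, Prod.norm_def, pow_succ]
    have hnn : ‖((n : ℂ) + 1)‖ = n + 1 := by exact_mod_cast Complex.norm_natCast (n + 1)
    rw [systemCoeff, max_mul_of_nonneg _ _ (by positivity), max_mul_of_nonneg _ _ hn.le]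
    apply max_le
    · simp only [norm_div, hnn]
      calc _ = ‖∑ k : Fin (n + 1), (systemCoeff c b p q k).1 * c (n - k)
              + b * (systemCoeff c b p q n).2‖ * R ^ n * R := by field_simp
        _ ≤ _ := by
          gcongr
          refine (mul_le_mul_of_nonneg_right (norm_add_le _ _) (by positivity)).trans ?_
          rw [add_mul, norm_mul, mul_assoc ‖b‖]
          gcongr
          exact hsnd n le_rfl
    · simp only [norm_div, hnn]
      calc _ = ‖b * (systemCoeff c b p q n).1‖ * R ^ n * R := by field_simp
        _ ≤ _ := by
          gcongr
          rw [norm_mul, mul_assoc ‖b‖]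
          have := mul_le_mul_of_nonneg_left (hfst n le_rfl) (norm_nonneg b)
          nlinarith [mul_nonneg hS0 hC0]
  obtain ⟨C, hC⟩ := bound (2 * (|R| + 1)) (by positivity)
  refine Summable.of_norm_bounded (summable_geometric_two.mul_left C) fun n => ?_
  have h1 : |R| ^ n ≤ (|R| + 1) ^ n := by gcongr; linarith
  have h2 := hC n
  rw [mul_pow] at h2
  rw [norm_mul, norm_norm, norm_pow, Real.norm_eq_abs, div_pow, one_pow, mul_one_div,
    le_div_iff₀ (by positivity)]
  calc _ ≤ ‖systemCoeff c b p q n‖ * (|R| + 1) ^ n * 2 ^ n := by gcongr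
    _ ≤ C := by linarith

/-- The linear system `u' = g u + b v`, `v' = b u` with entire `g` has entire solutions with
arbitrary initial values. -/
lemma exists_entire_solution {g : ℂ → ℂ} (hg : Differentiable ℂ g) (b t₀ p q : ℂ) :
    ∃ u v : ℂ → ℂ, (∀ t, HasDerivAt u (g t * u t + b * v t) t) ∧
      (∀ t, HasDerivAt v (b * u t) t) ∧ u t₀ = p ∧ v t₀ = q := by
  wlog h0 : t₀ = 0 generalizing g t₀
  · obtain ⟨u, v, hu, hv, hp, hq⟩ := this (g := fun t => g (t + t₀)) (by fun_prop) 0 rfl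
    refine ⟨fun t => u (t - t₀), fun t => v (t - t₀), fun t => ?_, fun t => ?_, by simpa, by simpa⟩
    · simpa using (hu (t - t₀)).comp_sub_const t t₀
    · simpa using (hv (t - t₀)).comp_sub_const t t₀
  subst h0
  set c : ℕ → ℂ := fun n => (n.factorial : ℂ)⁻¹ * iteratedDeriv n g 0 with hc_def
  have hgc : ∀ t, HasSum (fun n => c n * t ^ n) (g t) := fun t => by
    have := Complex.hasSum_taylorSeries_of_entire hg 0 t
    simpa [hc_def, mul_comm, mul_left_comm, mul_assoc] using this
  have hc : ∀ R : ℝ, Summable fun n => ‖c n‖ * R ^ n := fun R => by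
    have := (hgc R).summable.norm
    refine Summable.of_norm (this.congr fun n => ?_)
    simp
  set w := systemCoeff c b p q with hw
  have hws : ∀ R : ℝ, Summable fun n => ‖w n‖ * R ^ n :=
    summable_norm_systemCoeff_mul_pow b p q hc
  have hfst : ∀ R : ℝ, Summable fun n => ‖(w n).1‖ * R ^ n := fun R => by
    refine Summable.of_norm_bounded (hws |R|) fun n => ?_
    rw [norm_mul, norm_norm, norm_pow, Real.norm_eq_abs]
    gcongr
    exact norm_fst_le _
  have hsnd : ∀ R : ℝ, Summable fun n => ‖(w n).2‖ * R ^ n := fun R => by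
    refine Summable.of_norm_bounded (hws |R|) fun n => ?_
    rw [norm_mul, norm_norm, norm_pow, Real.norm_eq_abs]
    gcongr
    exact norm_snd_le _
  have toC : ∀ {d : ℕ → ℂ}, (∀ R : ℝ, Summable fun n => ‖d n‖ * R ^ n) → ∀ t : ℂ,
      Summable fun n => ‖d n * t ^ n‖ := fun hd t => by
    simpa using hd ‖t‖
  refine ⟨fun t => ∑' n, (w n).1 * t ^ n, fun t => ∑' n, (w n).2 * t ^ n, fun t => ?_, fun t => ?_,
    ?_, ?_⟩
  · convert hasDerivAt_tsum_mul_pow hfst t using 1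
    rw [← (hgc t).tsum_eq, mul_comm (∑' n, c n * t ^ n),
      tsum_mul_tsum_eq_tsum_sum_range_of_summable_norm (toC hfst t) (toC hc t), ← tsum_mul_left,
      ← Summable.tsum_add]
    · refine tsum_congr fun n => ?_
      have hn : ((n : ℂ) + 1) ≠ 0 := by exact_mod_cast n.succ_ne_zero
      rw [hw, systemCoeff, ← hw]
      simp only
      rw [mul_div_cancel₀ _ hn,
        Fin.sum_univ_eq_sum_range (fun k => (w k).1 * c (n - k)) (n + 1), add_mul, Finset.sum_mul,
        mul_assoc b]
      congr 1
      refine Finset.sum_congr rfl fun k hk => ?_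
      rw [← pow_mul_pow_sub t (Nat.lt_succ_iff.1 (Finset.mem_range.1 hk))]
      ring
    · exact (summable_norm_sum_mul_range_of_summable_norm (toC hfst t) (toC hc t)).of_norm
    · exact (toC hsnd t).of_norm.mul_left b
  · convert hasDerivAt_tsum_mul_pow hsnd t using 1
    rw [← tsum_mul_left]
    refine tsum_congr fun n => ?_
    have hn : ((n : ℂ) + 1) ≠ 0 := by exact_mod_cast n.succ_ne_zero
    rw [hw, systemCoeff, ← hw]
    simp only
    field_simp
  · simp only
    rw [tsum_eq_single 0 (by intro n hn; simp [hn])]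
    simp [hw, systemCoeff]
  · simp only
    rw [tsum_eq_single 0 (by intro n hn; simp [hn])]
    simp [hw, systemCoeff]

/-- On `[-π / 2, π / 2]` the system `u' = γ u + b v`, `v' = b u` with strong damping
`Re γ = -A cos` keeps `v` close to its initial value if `u` starts at zero. -/
lemma exists_forall_norm_sub_one_le_of_damped (b : ℝ) {ε : ℝ} (hε : 0 < ε) :
    ∃ A₀ : ℝ, 0 < A₀ ∧ ∀ A ≥ A₀, ∀ γ u v : ℝ → ℂ,
      (∀ t, HasDerivAt u (γ t * u t + b * v t) t) → (∀ t, HasDerivAt v (b * u t) t) →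
      (∀ t, (γ t).re = -A * cos t) → u (-(π / 2)) = 0 → v (-(π / 2)) = 1 →
      ‖v (π / 2) - 1‖ ≤ ε := by
  set Q : ℝ := exp (2 * |b| * π) with hQ
  have hQ1 : 1 ≤ Q := one_le_exp (by positivity)
  set δ : ℝ := min 1 (ε / (6 * ((|b| + 1) * Q))) with hδ
  have hδ0 : 0 < δ := by positivity
  have hδ1 : δ ≤ 1 := min_le_left _ _
  have hδb : 2 * (|b| * Q * δ) ≤ ε / 3 := by
    have h : δ ≤ ε / (6 * ((|b| + 1) * Q)) := min_le_right _ _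
    rw [le_div_iff₀ (by positivity)] at h
    nlinarith [mul_pos hδ0 (zero_lt_one.trans_le hQ1)]
  set η : ℝ := ε / (3 * ((|b| + 1) * π)) with hη
  have hη0 : 0 < η := by positivity
  have hηb : |b| * (η * π) ≤ ε / 3 := by
    have h : η * (3 * ((|b| + 1) * π)) = ε := by rw [hη]; field_simp
    nlinarith [mul_pos hη0 pi_pos]
  set κ : ℝ := sin δ with hκ
  have hκ0 : 0 < κ := sin_pos_of_pos_of_lt_pi hδ0 (by linarith [pi_gt_three])
  have hπ := pi_gt_three
  set L : ℝ := |b| * ((|b| * Q * π + Q) / (2 * η * κ)) with hL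
  have hL0 : 0 ≤ L := by positivity
  refine ⟨3 * (L + 1) / ε, by positivity, fun A hA γ u v hu hv hγ hu0 hv0 => ?_⟩
  have hA0 : 0 < A := lt_of_lt_of_le (by positivity) hA
  have hLA : L / A ≤ ε / 3 := by
    rw [ge_iff_le, div_le_iff₀ hε] at hA
    rw [div_le_iff₀ hA0]
    linarith
  have hcos : ∀ t ∈ Set.Icc (-(π / 2)) (π / 2), 0 ≤ cos t := fun t ht =>
    cos_nonneg_of_neg_pi_div_two_le_of_le ht.1 ht.2
  set N : ℝ → ℝ := fun t => ‖u t‖ ^ 2 with hN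
  set X : ℝ → ℝ := fun t => (u t).re * (v t).re + (u t).im * (v t).im with hX
  have hX_le : ∀ t, 2 * |X t| ≤ N t + ‖v t‖ ^ 2 := fun t => by
    simp only [hX, hN, Complex.sq_norm, Complex.normSq_apply]
    cases abs_cases ((u t).re * (v t).re + (u t).im * (v t).im) <;>
    nlinarith [sq_nonneg ((u t).re - (v t).re), sq_nonneg ((u t).im - (v t).im),
      sq_nonneg ((u t).re + (v t).re), sq_nonneg ((u t).im + (v t).im)]
  have hN' : ∀ t, HasDerivAt N (-2 * A * cos t * N t + 2 * b * X t) t := fun t => by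
    convert (hu t).norm_sq using 1
    simp only [hX, hN, Complex.sq_norm, Complex.normSq_apply, Complex.inner, Complex.mul_re,
      Complex.mul_im, Complex.add_re, Complex.add_im, Complex.conj_re, Complex.conj_im, hγ,
      Complex.ofReal_re, Complex.ofReal_im]
    ring
  have hV' : ∀ t, HasDerivAt (fun t => ‖v t‖ ^ 2) (2 * b * X t) t := fun t => by
    convert (hv t).norm_sq using 1
    simp only [hX, Complex.inner, Complex.mul_re,
      Complex.mul_im, Complex.conj_re, Complex.conj_im,
      Complex.ofReal_re, Complex.ofReal_im]
    ring
  have hbX : ∀ t, |b * X t| * 2 ≤ |b| * (N t + ‖v t‖ ^ 2) := fun t => by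
    rw [abs_mul]
    nlinarith [hX_le t, abs_nonneg b]
  have hE : ∀ t ∈ Set.Icc (-(π / 2)) (π / 2), N t + ‖v t‖ ^ 2 ≤ Q := by
    intro t ht
    have hd : ∀ t, HasDerivAt (fun t => (N t + ‖v t‖ ^ 2) * exp (-(2 * |b|) * t))
        ((-2 * A * cos t * N t + 2 * b * X t + 2 * b * X t) * exp (-(2 * |b|) * t)
          + (N t + ‖v t‖ ^ 2) * (exp (-(2 * |b|) * t) * (-(2 * |b|) * 1))) t := fun t =>
      ((hN' t).add (hV' t)).mul ((hasDerivAt_id t).const_mul (-(2 * |b|))).exp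
    have hanti : AntitoneOn (fun t => (N t + ‖v t‖ ^ 2) * exp (-(2 * |b|) * t))
        (Set.Icc (-(π / 2)) (π / 2)) := by
      apply antitoneOn_of_deriv_nonpos (convex_Icc _ _)
      · exact fun t _ => (hd t).continuousAt.continuousWithinAt
      · exact fun t _ => (hd t).differentiableAt.differentiableWithinAt
      · intro t ht
        rw [interior_Icc] at ht
        rw [(hd t).deriv]
        have h1 : 0 ≤ A * cos t * N t := by
          have := hcos t (Set.Ioo_subset_Icc_self ht)
          positivity
        have h2 := le_abs_self (b * X t)
        have h3 := hbX t
        have h4 := exp_pos (-(2 * |b|) * t)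
        have h5 : (-2 * A * cos t * N t + 2 * b * X t + 2 * b * X t)
            - 2 * |b| * (N t + ‖v t‖ ^ 2) ≤ 0 := by linarith
        nlinarith
    have h := hanti (Set.left_mem_Icc.2 (by linarith)) ht ht.1
    simp only [hN, hu0, hv0, norm_zero, norm_one] at h
    have h6 : (‖u t‖ ^ 2 + ‖v t‖ ^ 2) ≤ exp (2 * |b| * (t + π / 2)) := by
      have : exp (2 * |b| * (t + π / 2)) = exp (-(2 * |b|) * -(π / 2)) / exp (-(2 * |b|) * t) := by
        rw [← exp_sub]; congr 1; ring
      rw [this, le_div_iff₀ (exp_pos _)]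
      linarith
    refine h6.trans (exp_le_exp.2 ?_)
    have := ht.2
    gcongr
    linarith
  have hu_le : ∀ t ∈ Set.Icc (-(π / 2)) (π / 2), ‖u t‖ ≤ Q := fun t ht => by
    have h1 := hE t ht
    have h2 := sq_nonneg ‖v t‖
    simp only [hN] at h1
    nlinarith [norm_nonneg (u t)]
  have hend : ∀ p q, -(π / 2) ≤ p → p ≤ q → q ≤ π / 2 → ‖v q - v p‖ ≤ |b| * Q * (q - p) := by
    intro p q hp hpq hq
    refine norm_image_sub_le_of_norm_deriv_le_segment' (fun t _ => (hv t).hasDerivWithinAt)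
      (fun t ht => ?_) q (Set.right_mem_Icc.2 hpq)
    rw [norm_mul, Complex.norm_real, Real.norm_eq_abs]
    gcongr
    exact hu_le t ⟨hp.trans ht.1, ht.2.le.trans hq⟩
  have hmid : ‖v (π / 2 - δ) - v (-(π / 2) + δ)‖ ≤ |b| * (η * π) + L / A := by
    set p := -(π / 2) + δ with hp
    set q := π / 2 - δ with hq
    have hpq : p ≤ q := by linarith
    have hB : ∀ t, HasDerivAt (fun t => |b| * (η * (t - p) + (|b| * Q * (t - p) - (N t - N p)) /
        (2 * A * η * κ))) (|b| * (η * 1 + (|b| * Q * 1 -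
          (-2 * A * cos t * N t + 2 * b * X t)) / (2 * A * η * κ))) t := fun t =>
      (((((hasDerivAt_id t).sub_const p).const_mul η).add
        (((((hasDerivAt_id t).sub_const p).const_mul (|b| * Q)).sub
          ((hN' t).sub_const (N p))).div_const _)).const_mul |b|)
    have h := image_norm_le_of_norm_deriv_right_le_deriv_boundary (f := fun t => v t - v p)
      (a := p) (b := q)
      (fun t _ => ((hv t).sub_const (v p)).continuousAt.continuousWithinAt)
      (fun t _ => ((hv t).sub_const (v p)).hasDerivWithinAt) (by simp) hB ?_
      (Set.right_mem_Icc.2 hpq)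
    · refine h.trans ?_
      have hNq : 0 ≤ N q := by positivity
      have hNp : N p ≤ Q := by
        have := hE p ⟨by linarith, by linarith⟩
        have := sq_nonneg ‖v p‖
        linarith
      have : |b| * (η * π) + L / A
          = |b| * (η * π + (|b| * Q * π + Q) / (2 * A * η * κ)) := by
        rw [hL]; field_simp
      rw [this]
      gcongr
      · linarith
      · have : |b| * Q * (q - p) ≤ |b| * Q * π := by gcongr; linarith
        linarith
    · intro t ht
      have ht' : t ∈ Set.Icc (-(π / 2)) (π / 2) := ⟨by linarith [ht.1], by linarith [ht.2]⟩
      have hκt : κ ≤ cos t := by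
        rw [hκ, ← cos_pi_div_two_sub, ← cos_abs t]
        apply cos_le_cos_of_nonneg_of_le_pi (abs_nonneg _) (by linarith)
        rw [abs_le]
        exact ⟨by linarith [ht.1], by linarith [ht.2]⟩
      rw [norm_mul, Complex.norm_real, Real.norm_eq_abs]
      gcongr
      have h1 : 2 * A * κ * N t ≤ |b| * Q * 1 - (-2 * A * cos t * N t + 2 * b * X t) := by
        have h2 := hbX t
        have h3 := le_abs_self (b * X t)
        have h4 : |b| * (N t + ‖v t‖ ^ 2) ≤ |b| * Q := by gcongr; exact hE t ht'
        have h5 : A * κ * N t ≤ A * cos t * N t := by gcongr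
        linarith
      calc ‖u t‖ ≤ η * 1 + 2 * A * κ * N t / (2 * A * η * κ) := by
            have : 2 * A * κ * N t / (2 * A * η * κ) = ‖u t‖ ^ 2 / η := by
              simp only [hN]; field_simp
            rw [this, mul_one, ← sub_le_iff_le_add', le_div_iff₀ hη0]
            nlinarith [sq_nonneg (‖u t‖ - η), norm_nonneg (u t)]
        _ ≤ _ := by gcongr
  have h1 := hend (-(π / 2)) (-(π / 2) + δ) le_rfl (by linarith) (by linarith)
  have h2 := hend (π / 2 - δ) (π / 2) (by linarith) (by linarith) le_rfl
  rw [hv0] at h1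
  have h3 : v (π / 2) - 1 = (v (π / 2) - v (π / 2 - δ)) + (v (π / 2 - δ) - v (-(π / 2) + δ))
      + (v (-(π / 2) + δ) - 1) := by ring
  rw [h3]
  refine norm_add₃_le.trans ?_
  ring_nf at h1 h2 hmid hδb hηb hLA ⊢
  linarith

/-- Entire solutions of the linear system `u' = g u + b v`, `v' = b u`. -/
structure IsSystemSolution (g : ℂ → ℂ) (b : ℂ) (u v : ℂ → ℂ) : Prop where
  hasDerivAt_fst : ∀ t, HasDerivAt u (g t * u t + b * v t) t
  hasDerivAt_snd : ∀ t, HasDerivAt v (b * u t) t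

namespace IsSystemSolution

variable {g : ℂ → ℂ} {b : ℂ} {u v u₁ v₁ u₂ v₂ : ℂ → ℂ}

lemma linearCombination (h₁ : IsSystemSolution g b u₁ v₁) (h₂ : IsSystemSolution g b u₂ v₂)
    (k₁ k₂ : ℂ) :
    IsSystemSolution g b (fun t => k₁ * u₁ t + k₂ * u₂ t) (fun t => k₁ * v₁ t + k₂ * v₂ t) where
  hasDerivAt_fst t := by
    refine HasDerivAt.congr_deriv (((h₁.hasDerivAt_fst t).const_mul k₁).add
      ((h₂.hasDerivAt_fst t).const_mul k₂)) ?_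
    ring
  hasDerivAt_snd t := by
    refine HasDerivAt.congr_deriv (((h₁.hasDerivAt_snd t).const_mul k₁).add
      ((h₂.hasDerivAt_snd t).const_mul k₂)) ?_
    ring

lemma comp_add_const (h : IsSystemSolution g b u v) {T : ℂ} (hT : ∀ t, g (t + T) = g t) :
    IsSystemSolution g b (fun t => u (t + T)) (fun t => v (t + T)) where
  hasDerivAt_fst t := by simpa [hT] using (h.hasDerivAt_fst (t + T)).comp_add_const t T
  hasDerivAt_snd t := (h.hasDerivAt_snd (t + T)).comp_add_const t T

/-- A solution that vanishes at one point vanishes identically. -/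
lemma eq_zero (h : IsSystemSolution g b u v) (hg : Continuous g) {t₀ : ℂ} (hu : u t₀ = 0)
    (hv : v t₀ = 0) (t : ℂ) : u t = 0 ∧ v t = 0 := by
  set l : ℝ → ℂ := fun σ => t₀ + σ * (t - t₀) with hl
  have hl' : ∀ σ, HasDerivAt l (t - t₀) σ := fun σ => by
    simpa [hl] using ((((hasDerivAt_id (σ : ℂ)).comp_ofReal).mul_const (t - t₀)).const_add t₀)
  have hlc : Continuous l := by fun_prop
  obtain ⟨G, hG⟩ := isCompact_Icc.exists_bound_of_continuousOn
    (f := fun σ => g (l σ)) (s := Set.Icc (0 : ℝ) 1) (hg.comp hlc).continuousOn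
  have hd : ∀ σ, HasDerivAt (fun σ => (u (l σ), v (l σ)))
      ((g (l σ) * u (l σ) + b * v (l σ)) * (t - t₀), b * u (l σ) * (t - t₀)) σ := fun σ =>
    ((h.hasDerivAt_fst (l σ)).comp σ (hl' σ)).prodMk ((h.hasDerivAt_snd (l σ)).comp σ (hl' σ))
  have key := eq_zero_of_abs_deriv_le_mul_abs_self_of_eq_zero_right (a := 0) (b := 1)
    (K := (G + ‖b‖) * ‖t - t₀‖)
    (fun σ _ => (hd σ).continuousAt.continuousWithinAt) (fun σ _ => (hd σ).hasDerivWithinAt)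
    (by simp [hl, hu, hv]) ?_ 1 (by simp)
  · simpa [hl] using key
  · intro σ hσ
    have hGσ := hG σ (Set.Ico_subset_Icc_self hσ)
    have h1 := norm_fst_le (u (l σ), v (l σ))
    have h2 := norm_snd_le (u (l σ), v (l σ))
    have hG0 : 0 ≤ G := (norm_nonneg _).trans hGσ
    simp only at h1 h2
    rw [Prod.norm_mk]
    apply max_le
    · rw [norm_mul, mul_right_comm]
      gcongr
      refine (norm_add_le _ _).trans ?_
      rw [norm_mul, norm_mul, add_mul]
      gcongr
    · rw [norm_mul, norm_mul, mul_right_comm]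
      gcongr
      linarith

/-- Solutions with the same value at one point coincide. -/
lemma unique (h₁ : IsSystemSolution g b u₁ v₁) (h₂ : IsSystemSolution g b u₂ v₂)
    (hg : Continuous g) {t₀ : ℂ} (hu : u₁ t₀ = u₂ t₀) (hv : v₁ t₀ = v₂ t₀) (t : ℂ) :
    u₁ t = u₂ t ∧ v₁ t = v₂ t := by
  have := (h₁.linearCombination h₂ 1 (-1)).eq_zero hg (t₀ := t₀) (by simp [hu]) (by simp [hv]) t
  constructor
  · linear_combination this.1
  · linear_combination this.2

end IsSystemSolution

/-- The coefficient `i (a + s sin t)` of the linearization of the class-D equation. -/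
noncomputable def classDCoeff (a s : ℝ) (t : ℂ) : ℂ :=
  Complex.I * (a + s * Complex.sin t)

lemma differentiable_classDCoeff (a s : ℝ) : Differentiable ℂ (classDCoeff a s) := by
  unfold classDCoeff
  fun_prop

lemma classDCoeff_add_two_pi (a s : ℝ) (t : ℂ) :
    classDCoeff a s (t + 2 * π) = classDCoeff a s t := by
  simp [classDCoeff, Complex.sin_add_two_pi]

lemma classDCoeff_re (a s θ τ : ℝ) :
    (classDCoeff a s (θ + τ * Complex.I)).re = -(s * sinh τ) * cos θ := by
  rw [classDCoeff, Complex.sin_add_mul_I, ← Complex.ofReal_sin, ← Complex.ofReal_cos,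
    ← Complex.ofReal_cosh, ← Complex.ofReal_sinh]
  simp only [Complex.mul_re, Complex.mul_im, Complex.add_re, Complex.add_im, Complex.I_re,
    Complex.I_im, Complex.ofReal_re, Complex.ofReal_im]
  ring

section Linearization

variable {ν a s : ℝ} {u v : ℂ → ℂ}

/-- On the real axis the difference of the squared absolute values of the components of a solution
is constant. -/
lemma norm_eq_norm_of_isSystemSolution
    (h : IsSystemSolution (classDCoeff a s) (-(ν / 2) : ℝ) u v) (h0 : ‖u 0‖ = ‖v 0‖) (t : ℝ) :
    ‖u t‖ = ‖v t‖ := by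
  have hd : ∀ t : ℝ, HasDerivAt (fun t : ℝ => ‖u t‖ ^ 2 - ‖v t‖ ^ 2) 0 t := fun t => by
    refine HasDerivAt.congr_deriv (((h.hasDerivAt_fst t).comp_ofReal.norm_sq).sub
      ((h.hasDerivAt_snd t).comp_ofReal.norm_sq)) ?_
    have hre : (classDCoeff a s t).re = 0 := by simpa using classDCoeff_re a s t 0
    simp only [Complex.inner, Complex.mul_re,
      Complex.mul_im, Complex.add_re, Complex.add_im, Complex.conj_re, Complex.conj_im, hre,
      Complex.ofReal_re, Complex.ofReal_im]
    ring
  have := is_const_of_deriv_eq_zero (fun t => (hd t).differentiableAt) (fun t => (hd t).deriv) t 0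
  simp only [Complex.ofReal_zero, h0, sub_self] at this
  exact (pow_left_inj₀ (norm_nonneg _) (norm_nonneg _) two_ne_zero).1 (sub_eq_zero.1 this)

/-- A solution of the linear system with initial value `(exp (i α), 1)` is the linearization of a
solution of the class-D equation with initial value `α`. -/
lemma exists_isClassDSolution_of_isSystemSolution
    (h : IsSystemSolution (classDCoeff a s) (-(ν / 2) : ℝ) u v) {α : ℝ}
    (hu : u 0 = Complex.exp (α * Complex.I)) (hv : v 0 = 1) :
    ∃ x : ℝ → ℝ, IsClassDSolution ν a s x ∧ x 0 = α ∧
      ∀ t : ℝ, u t = Complex.exp (x t * Complex.I) * v t := by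
  have hnorm : ∀ t : ℝ, ‖u t‖ = ‖v t‖ := norm_eq_norm_of_isSystemSolution h
    (by rw [hu, hv, Complex.norm_exp_ofReal_mul_I, norm_one])
  have hv0 : ∀ t : ℝ, v t ≠ 0 := fun t ht => by
    have hut : u t = 0 := by rw [← norm_eq_zero, hnorm, ht, norm_zero]
    have := (h.eq_zero (differentiable_classDCoeff a s).continuous hut ht 0).2
    rw [hv] at this
    exact one_ne_zero this
  have hvd : ∀ t : ℝ, HasDerivAt (fun t : ℝ => v t) _ t := fun t => (h.hasDerivAt_snd t).comp_ofReal
  have hud : ∀ t : ℝ, HasDerivAt (fun t : ℝ => u t) _ t := fun t => (h.hasDerivAt_fst t).comp_ofReal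
  set Φ : ℝ → ℂ := fun t => u t / v t with hΦ
  have hΦd : ∀ t : ℝ, HasDerivAt Φ _ t := fun t => (hud t).div (hvd t) (hv0 t)
  have hΦ1 : ∀ t, Φ t * (starRingEnd ℂ) (Φ t) = 1 := fun t => by
    rw [Complex.mul_conj, Complex.normSq_eq_norm_sq, hΦ]
    simp [hnorm, hv0]
  set f : ℝ → ℝ := fun t => ν * (Φ t).im + a + s * sin t with hf
  have hfc : Continuous f := by
    have : Continuous Φ := continuous_iff_continuousAt.2 fun t => (hΦd t).continuousAt
    fun_prop
  set x : ℝ → ℝ := fun t => α + ∫ σ in (0 : ℝ)..t, f σ with hx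
  have hxd : ∀ t, HasDerivAt x (f t) t := fun t =>
    (intervalIntegral.integral_hasDerivAt_right (hfc.intervalIntegrable _ _)
      (hfc.stronglyMeasurableAtFilter _ _) hfc.continuousAt).const_add α
  have hΨ : ∀ t, HasDerivAt (fun t => Φ t * Complex.exp (-(x t * Complex.I))) 0 t := fun t => by
    refine HasDerivAt.congr_deriv ((hΦd t).mul
      (((hxd t).ofReal_comp.mul_const Complex.I).neg.cexp)) ?_
    have hsub : (starRingEnd ℂ) (Φ t) = Φ t - 2 * (Φ t).im * Complex.I := by
      apply Complex.ext <;> simp; ring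
    have hone : Φ t * (Φ t - 2 * (Φ t).im * Complex.I) = 1 := hsub ▸ hΦ1 t
    have hquot : ((classDCoeff a s t * u t + (-(ν / 2) : ℝ) * v t) * v t
        - u t * ((-(ν / 2) : ℝ) * u t)) / v t ^ 2
        = classDCoeff a s t * Φ t - ν / 2 + ν / 2 * Φ t ^ 2 := by
      have := hv0 t
      simp only [hΦ]
      push_cast
      field_simp
      ring
    rw [hquot]
    simp only [hf, classDCoeff]
    push_cast
    linear_combination ((ν : ℂ) / 2 * Complex.exp (-(x t * Complex.I))) * hone
  have hu_eq : ∀ t : ℝ, Φ t = Complex.exp (x t * Complex.I) := fun t => by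
    have := is_const_of_deriv_eq_zero (fun t => (hΨ t).differentiableAt) (fun t => (hΨ t).deriv) t 0
    simp only [hΦ, hx, Complex.ofReal_zero, hu, hv, div_one, intervalIntegral.integral_same,
      add_zero, ← Complex.exp_add, add_neg_cancel, Complex.exp_zero] at this
    rw [Complex.exp_neg, mul_inv_eq_one₀ (Complex.exp_ne_zero _)] at this
    exact this
  refine ⟨x, fun t => ?_, by simp [hx], fun t => ?_⟩
  · refine (hxd t).congr_deriv ?_
    simp only [hf, hu_eq, Complex.exp_ofReal_mul_I_im]
  · rw [← hu_eq, hΦ, div_mul_cancel₀ _ (hv0 t)]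

/-- At a constriction the monodromy of the linear system is a scalar `l` with
`l ^ 2 = exp (2 π i a)`. -/
lemma exists_scalar_monodromy {r : ℤ}
    (hr : ∀ x : ℝ → ℝ, IsClassDSolution ν a s x → x (2 * π) = x 0 + 2 * π * r) :
    ∃ l : ℂ, l ^ 2 = Complex.exp (2 * π * a * Complex.I) ∧
      ∀ u v : ℂ → ℂ, IsSystemSolution (classDCoeff a s) (-(ν / 2) : ℝ) u v →
        ∀ t, v (t + 2 * π) = l * v t := by
  have hg := differentiable_classDCoeff a s
  set b : ℂ := ((-(ν / 2) : ℝ) : ℂ) with hb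
  obtain ⟨u₁, v₁, hu₁, hv₁, hp₁, hq₁⟩ := exists_entire_solution hg b 0 1 0
  obtain ⟨u₂, v₂, hu₂, hv₂, hp₂, hq₂⟩ := exists_entire_solution hg b 0 0 1
  have h₁ : IsSystemSolution (classDCoeff a s) b u₁ v₁ := ⟨hu₁, hv₁⟩
  have h₂ : IsSystemSolution (classDCoeff a s) b u₂ v₂ := ⟨hu₂, hv₂⟩
  have eigen : ∀ α : ℝ, Complex.exp (α * Complex.I) * u₁ (2 * π) + u₂ (2 * π)
      = Complex.exp (α * Complex.I) * (Complex.exp (α * Complex.I) * v₁ (2 * π) + v₂ (2 * π)) := by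
    intro α
    obtain ⟨x, hx, hx0, hux⟩ := exists_isClassDSolution_of_isSystemSolution (α := α)
      (h₁.linearCombination h₂ (Complex.exp (α * Complex.I)) 1) (by simp [hp₁, hp₂])
      (by simp [hq₁, hq₂])
    have h := hux (2 * π)
    rw [hr x hx, hx0] at h
    have hper : Complex.exp (((α + 2 * π * r : ℝ) : ℂ) * Complex.I)
        = Complex.exp (α * Complex.I) := by
      rw [Complex.exp_eq_exp_iff_exists_int]
      exact ⟨r, by push_cast; ring⟩
    rw [hper] at h
    push_cast at h
    linear_combination h
  have e0 := eigen 0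
  have e1 := eigen π
  have e2 := eigen (π / 2)
  rw [Complex.exp_pi_mul_I] at e1
  push_cast at e2
  rw [Complex.exp_pi_div_two_mul_I] at e2
  simp only [Complex.ofReal_zero, zero_mul, Complex.exp_zero, one_mul] at e0
  have hdiag : u₁ (2 * π) = v₂ (2 * π) := by linear_combination (e0 - e1) / 2
  have hanti : u₂ (2 * π) = v₁ (2 * π) := by linear_combination (e0 + e1) / 2
  have hv₁0 : v₁ (2 * π) = 0 := by
    linear_combination (e2 - hanti - Complex.I * hdiag + Complex.I_sq * v₁ (2 * π)) / 2
  have hu₂0 : u₂ (2 * π) = 0 := hanti.trans hv₁0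
  refine ⟨v₂ (2 * π), ?_, fun u v h t => ?_⟩
  · have hW : ∀ t, HasDerivAt (fun t => (u₁ t * v₂ t - u₂ t * v₁ t) *
        Complex.exp (-(Complex.I * (a * t - s * Complex.cos t)))) 0 t := fun t => by
      refine HasDerivAt.congr_deriv ((((hu₁ t).mul (hv₂ t)).sub ((hu₂ t).mul (hv₁ t))).mul
        ((((((hasDerivAt_id t).const_mul (a : ℂ)).sub
          ((Complex.hasDerivAt_cos t).const_mul (s : ℂ))).const_mul Complex.I).neg).cexp)) ?_
      simp only [classDCoeff, id, Pi.sub_apply, Pi.mul_apply, Pi.neg_apply]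
      ring
    have h := is_const_of_deriv_eq_zero (fun t => (hW t).differentiableAt) (fun t => (hW t).deriv)
      (2 * π) 0
    simp only [hp₁, hq₁, hp₂, hq₂, hdiag, hv₁0, hu₂0, Complex.cos_two_pi, Complex.cos_zero] at h
    have hsplit : Complex.exp (-(Complex.I * (a * 0 - s * 1)))
        = Complex.exp (2 * π * a * Complex.I)
          * Complex.exp (-(Complex.I * (a * (2 * π) - s * 1))) := by
      rw [← Complex.exp_add]
      congr 1
      ring
    rw [hsplit] at h
    refine mul_right_cancel₀ (Complex.exp_ne_zero (-(Complex.I * (a * (2 * π) - s * 1)))) ?_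
    linear_combination h
  · have hrep := h.unique (h₁.linearCombination h₂ (u 0) (v 0)) hg.continuous (t₀ := 0)
      (by simp [hp₁, hp₂]) (by simp [hq₁, hq₂]) (2 * π)
    have hzero := ((h.comp_add_const (classDCoeff_add_two_pi a s)).linearCombination h 1
      (-v₂ (2 * π))).eq_zero hg.continuous (t₀ := 0)
      (by simp only [zero_add, hrep.1, hdiag, hu₂0]; ring)
      (by simp only [zero_add, hrep.2, hv₁0]; ring) t
    linear_combination hzero.2

/-- A scalar monodromy of the linear system is trivial. -/
lemma eq_one_of_scalar_monodromy (hs : s ≠ 0) {l : ℂ}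
    (hl : ∀ u v : ℂ → ℂ, IsSystemSolution (classDCoeff a s) (-(ν / 2) : ℝ) u v →
        ∀ t, v (t + 2 * π) = l * v t) : l = 1 := by
  have key : ∀ ε > 0, ‖l - 1‖ ≤ ε * (‖l‖ + 1) := by
    intro ε hε
    obtain ⟨A₁, hA₁, H₁⟩ := exists_forall_norm_sub_one_le_of_damped (-(ν / 2)) hε
    obtain ⟨A₂, hA₂, H₂⟩ := exists_forall_norm_sub_one_le_of_damped (ν / 2) hε
    set A := max A₁ A₂ with hA
    set τ := arsinh (A / s) with hτ
    have hsτ : s * sinh τ = A := by rw [hτ, sinh_arsinh]; field_simp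
    obtain ⟨u, v, hu, hv, hp, hq⟩ := exists_entire_solution (differentiable_classDCoeff a s)
      ((-(ν / 2) : ℝ) : ℂ) ((-(π / 2) : ℝ) + τ * Complex.I) 0 1
    have hright : ‖v ((π / 2 : ℝ) + τ * Complex.I) - 1‖ ≤ ε := by
      refine H₁ A (le_max_left _ _) (fun θ => classDCoeff a s (θ + τ * Complex.I))
        (fun θ => u (θ + τ * Complex.I)) (fun θ => v (θ + τ * Complex.I)) (fun θ => ?_)
        (fun θ => ?_) (fun θ => ?_) hp hq
      · exact ((hu (θ + τ * Complex.I)).comp_add_const (θ : ℂ) _).comp_ofReal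
      · exact ((hv (θ + τ * Complex.I)).comp_add_const (θ : ℂ) _).comp_ofReal
      · rw [classDCoeff_re, hsτ]
    have hleft : ‖v ((-π - π / 2 : ℝ) + τ * Complex.I) - 1‖ ≤ ε := by
      have hline : ∀ θ : ℝ, HasDerivAt (fun θ : ℝ => ((-π - θ : ℝ) : ℂ) + τ * Complex.I) (-1) θ :=
        fun θ => by
          simpa using (((hasDerivAt_id θ).const_sub (-π)).ofReal_comp).add_const (τ * Complex.I)
      refine H₂ A (le_max_right _ _)
        (fun θ => -classDCoeff a s ((-π - θ : ℝ) + τ * Complex.I))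
        (fun θ => u ((-π - θ : ℝ) + τ * Complex.I)) (fun θ => v ((-π - θ : ℝ) + τ * Complex.I))
        (fun θ => ?_) (fun θ => ?_) (fun θ => ?_) ?_ ?_
      · refine HasDerivAt.congr_deriv ((hu _).comp θ (hline θ)) ?_
        push_cast
        ring
      · refine HasDerivAt.congr_deriv ((hv _).comp θ (hline θ)) ?_
        push_cast
        ring
      · rw [Complex.neg_re, classDCoeff_re, hsτ, ← cos_neg (-π - θ)]
        rw [show -(-π - θ) = θ + π by ring, cos_add_pi]
        ring
      · rw [← hp]; congr 3; ring
      · rw [← hq]; congr 3; ring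
    have hshift := hl u v ⟨hu, hv⟩ ((-π - π / 2 : ℝ) + τ * Complex.I)
    rw [show ((-π - π / 2 : ℝ) : ℂ) + τ * Complex.I + 2 * π = (π / 2 : ℝ) + τ * Complex.I by
      push_cast; ring] at hshift
    rw [hshift] at hright
    set q := v ((-π - π / 2 : ℝ) + τ * Complex.I)
    calc ‖l - 1‖ = ‖(l * q - 1) - l * (q - 1)‖ := by congr 1; ring
      _ ≤ ‖l * q - 1‖ + ‖l‖ * ‖q - 1‖ := by rw [← norm_mul]; exact norm_sub_le _ _
      _ ≤ ε + ‖l‖ * ε := by gcongr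
      _ = ε * (‖l‖ + 1) := by ring
  rw [← sub_eq_zero, ← norm_le_zero_iff]
  refine le_of_forall_pos_le_add fun ε hε => ?_
  have := key (ε / (‖l‖ + 1)) (by positivity)
  rwa [div_mul_cancel₀ _ (by positivity), ← zero_add ε] at this

/-- The parameter `a` of a constriction is an integer. -/
lemma exists_int_eq_of_constriction (hs : s ≠ 0) {r : ℤ}
    (hr : ∀ x : ℝ → ℝ, IsClassDSolution ν a s x → x (2 * π) = x 0 + 2 * π * r) :
    ∃ n : ℤ, a = n := by
  obtain ⟨l, hl2, hl⟩ := exists_scalar_monodromy hr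
  rw [eq_one_of_scalar_monodromy hs hl, one_pow] at hl2
  obtain ⟨n, hn⟩ := Complex.exp_eq_one_iff.1 hl2.symm
  refine ⟨n, ?_⟩
  have h2 : (2 * π * Complex.I : ℂ) ≠ 0 := Complex.two_pi_I_ne_zero
  have : (a : ℂ) = n := mul_left_cancel₀ h2 (by linear_combination hn)
  exact_mod_cast this

end Linearization

/-- The class-D equation has a solution. -/
lemma exists_isClassDSolution (ν a s : ℝ) : ∃ x, IsClassDSolution ν a s x := by
  obtain ⟨u, v, hu, hv, hp, hq⟩ := exists_entire_solution (differentiable_classDCoeff a s)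
    ((-(ν / 2) : ℝ) : ℂ) 0 1 1
  obtain ⟨x, hx, -⟩ := exists_isClassDSolution_of_isSystemSolution (α := 0) ⟨hu, hv⟩
    (by simpa using hp) hq
  exact ⟨x, hx⟩

/-- Where `sin t` is bounded away from zero, `x - a t + s cos t` varies by `O(1 / s)` along a
solution of the class-D equation. -/
lemma abs_sub_le_of_le_abs_sin {ν a s κ p q : ℝ} {x : ℝ → ℝ} (hx : IsClassDSolution ν a s x)
    (hs : s ≠ 0) (hκ : 0 < κ) (hpq : p ≤ q) (hsin : ∀ t ∈ Set.Icc p q, κ ≤ |sin t|) :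
    |(x q - a * q + s * cos q) - (x p - a * p + s * cos p)| ≤
      (|ν| * (|ν| + |a|) / κ + |ν| / κ ^ 2) * (q - p) / |s| + 2 * (|ν| / κ) / |s| := by
  have hsin0 : ∀ t ∈ Set.Icc p q, sin t ≠ 0 := fun t ht =>
    abs_pos.1 (hκ.trans_le (hsin t ht))
  set F : ℝ → ℝ := fun t => x t - a * t + s * cos t with hF
  set B : ℝ → ℝ := fun t => ν * cos (x t) / (s * sin t) with hB
  have hH : ∀ t ∈ Set.Icc p q, HasDerivAt (fun t => F t + B t)
      (-(ν * sin (x t) * (ν * sin (x t) + a) / (s * sin t))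
        - ν * cos (x t) * cos t / (s * sin t ^ 2)) t := by
    intro t ht
    have h0 := hsin0 t ht
    have hFd : HasDerivAt F _ t :=
      ((hx t).sub ((hasDerivAt_id t).const_mul a)).add ((hasDerivAt_cos t).const_mul s)
    have hBd : HasDerivAt B _ t := (((hx t).cos).const_mul ν).div
      ((hasDerivAt_sin t).const_mul s) (mul_ne_zero hs h0)
    refine HasDerivAt.congr_deriv (hFd.add hBd) ?_
    field_simp
    ring
  have hmain := norm_image_sub_le_of_norm_deriv_le_segment'
    (fun t ht => (hH t ht).hasDerivWithinAt)
    (C := (|ν| * (|ν| + |a|) / κ + |ν| / κ ^ 2) / |s|) (fun t ht => ?_) q (Set.right_mem_Icc.2 hpq)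
  · have hBb : ∀ t ∈ Set.Icc p q, |B t| ≤ |ν| / κ / |s| := fun t ht => by
      have h1 := hsin t ht
      simp only [hB]
      rw [abs_div, abs_mul, abs_mul, div_div, mul_comm κ]
      gcongr
      exact mul_le_of_le_one_right (abs_nonneg _) (abs_cos_le_one _)
    have h1 := hBb p (Set.left_mem_Icc.2 hpq)
    have h2 := hBb q (Set.right_mem_Icc.2 hpq)
    rw [Real.norm_eq_abs] at hmain
    have h3 : F q - F p = (F q + B q - (F p + B p)) - B q + B p := by ring
    change |F q - F p| ≤ _
    rw [h3]
    calc _ ≤ |F q + B q - (F p + B p)| + |B q| + |B p| :=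
          (abs_add_le _ _).trans (add_le_add_left (abs_sub _ _) _)
      _ ≤ (|ν| * (|ν| + |a|) / κ + |ν| / κ ^ 2) / |s| * (q - p) + |ν| / κ / |s|
          + |ν| / κ / |s| := by gcongr
      _ = _ := by ring
  · have h1 := hsin t (Set.Ico_subset_Icc_self ht)
    have h2 : |ν * sin (x t) + a| ≤ |ν| + |a| := (abs_add_le _ _).trans (by
      rw [abs_mul]
      gcongr
      exact mul_le_of_le_one_right (abs_nonneg _) (abs_sin_le_one _))
    rw [Real.norm_eq_abs]
    refine (abs_sub _ _).trans ?_
    rw [abs_neg, add_div, div_div, div_div, mul_comm κ, mul_comm (κ ^ 2)]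
    simp only [abs_div, abs_mul, abs_pow]
    gcongr
    · exact mul_le_of_le_one_right (abs_nonneg _) (abs_sin_le_one _)
    · rw [mul_assoc]
      exact mul_le_of_le_one_right (abs_nonneg _)
        (mul_le_one₀ (abs_cos_le_one _) (abs_nonneg _) (abs_cos_le_one _))

/-- Far from the axis `s = 0`, a constriction with rotation number `r` has `|a - r| < 1`. -/
lemma exists_forall_abs_sub_lt_one (ν : ℝ) (r : ℤ) :
    ∃ M : ℝ, 0 < M ∧ ∀ a s : ℝ, M < |s| →
      (∀ x : ℝ → ℝ, IsClassDSolution ν a s x → x (2 * π) = x 0 + 2 * π * r) → |a - r| < 1 := by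
  have hπ := pi_gt_three
  set δ : ℝ := 1 / (|ν| + 1) with hδ
  have hδ0 : 0 < δ := by positivity
  have hδ1 : δ ≤ 1 := by
    rw [hδ, div_le_one (by positivity)]
    linarith [abs_nonneg ν]
  have hνδ : |ν| * δ ≤ 1 := by
    rw [hδ, mul_one_div, div_le_one (by positivity)]
    linarith
  set κ : ℝ := sin δ with hκ
  have hκ0 : 0 < κ := sin_pos_of_pos_of_lt_pi hδ0 (by linarith)
  set L : ℝ := (|ν| * (|ν| + (|ν| + |(r : ℝ)|)) / κ + |ν| / κ ^ 2) * π + 2 * (|ν| / κ) with hL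
  have hL0 : 0 ≤ L := by positivity
  refine ⟨L + 1, by positivity, fun a s hs hr => ?_⟩
  have hs0 : 0 < |s| := by linarith
  obtain ⟨x, hx⟩ := exists_isClassDSolution ν a s
  set F : ℝ → ℝ := fun t => x t - a * t + s * cos t with hF
  have hFd : ∀ t, HasDerivAt F (ν * sin (x t)) t := fun t => by
    refine HasDerivAt.congr_deriv (((hx t).sub ((hasDerivAt_id t).const_mul a)).add
      ((hasDerivAt_cos t).const_mul s)) ?_
    ring
  have hshort : ∀ p q, p ≤ q → |F q - F p| ≤ |ν| * (q - p) := fun p q hpq => by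
    refine norm_image_sub_le_of_norm_deriv_le_segment' (fun t _ => (hFd t).hasDerivWithinAt)
      (fun t _ => ?_) q (Set.right_mem_Icc.2 hpq)
    rw [Real.norm_eq_abs, abs_mul]
    exact mul_le_of_le_one_right (abs_nonneg _) (abs_sin_le_one _)
  have htot : F (2 * π) - F 0 = 2 * π * (r - a) := by
    simp only [hF, hr x hx, cos_two_pi, cos_zero]
    ring
  have ha : |a| ≤ |ν| + |(r : ℝ)| := by
    have h := hshort 0 (2 * π) (by positivity)
    rw [htot, abs_mul, abs_of_pos (by positivity : 0 < 2 * π), sub_zero, mul_comm |ν|] at h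
    have h1 := le_of_mul_le_mul_left h (by positivity)
    have h2 : |a| ≤ |(r : ℝ)| + |r - a| := by
      calc |a| = |r - (r - a)| := by congr 1; ring
        _ ≤ _ := abs_sub _ _
    linarith
  have hlong : ∀ p q, p ≤ q → q - p ≤ π → (∀ t ∈ Set.Icc p q, κ ≤ |sin t|) →
      |F q - F p| < 1 := by
    intro p q hpq hqp hsin
    refine (abs_sub_le_of_le_abs_sin hx (abs_pos.1 hs0) hκ0 hpq hsin).trans_lt ?_
    rw [← add_div, div_lt_one hs0]
    refine lt_of_le_of_lt ?_ ((lt_add_one L).trans hs)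
    rw [hL]
    gcongr
  have hsin : ∀ t ∈ Set.Icc δ (π - δ), κ ≤ sin t := by
    intro t ht
    rw [hκ, ← cos_pi_div_two_sub, ← cos_pi_div_two_sub, ← cos_abs (π / 2 - t)]
    apply cos_le_cos_of_nonneg_of_le_pi (abs_nonneg _) (by linarith)
    rw [abs_le]
    exact ⟨by linarith [ht.2], by linarith [ht.1]⟩
  have h1 := hshort 0 δ hδ0.le
  have h2 := hlong δ (π - δ) (by linarith) (by linarith) fun t ht =>
    (hsin t ht).trans (le_abs_self _)
  have h3 := hshort (π - δ) (π + δ) (by linarith)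
  have h4 := hlong (π + δ) (2 * π - δ) (by linarith) (by linarith) fun t ht => by
    have := hsin (t - π) ⟨by linarith [ht.1], by linarith [ht.2]⟩
    rw [sin_sub_pi] at this
    exact this.trans (neg_le_abs _)
  have h5 := hshort (2 * π - δ) (2 * π) (by linarith)
  have h6 : |F (2 * π) - F 0| < 2 * π := by
    rw [abs_le] at h1 h3 h5
    rw [abs_lt] at h2 h4 ⊢
    ring_nf at h1 h2 h3 h4 h5 hνδ ⊢
    constructor <;> linarith
  rw [htot, abs_mul, abs_of_pos (by positivity : 0 < 2 * π)] at h6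
  rw [abs_sub_comm]
  nlinarith

/-- For every `ν ≠ 0` and `r ∈ ℤ` there exists `M > 0` such that every
constriction `(a, s)` with rotation number `r` and `|s| > M` satisfies `a = r`. -/
theorem constrictions_far_from_axis_lie_on_line
    (ν : ℝ) (hν : ν ≠ 0) (r : ℤ) :
    ∃ M : ℝ, 0 < M ∧ ∀ a s : ℝ, M < |s| →
      (∀ x : ℝ → ℝ, IsClassDSolution ν a s x →
        x (2 * π) = x 0 + 2 * π * (r : ℝ)) →
      a = (r : ℝ) := by
  obtain ⟨M, hM, H⟩ := exists_forall_abs_sub_lt_one ν r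
  refine ⟨M, hM, fun a s hs hr => ?_⟩
  have hlt := H a s hs hr
  obtain ⟨n, rfl⟩ := exists_int_eq_of_constriction (abs_pos.1 (hM.trans hs)) hr
  have hn : |n - r| < 1 := by exact_mod_cast hlt
  rw [sub_eq_zero.1 (Int.abs_lt_one_iff.1 hn)]
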